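/- For all integers a ≥ 2 and b ≥ 2 with n = a + 2b − 1, there is no smooth Fano n-polytope R with n + 4 vertices such that V(P(a,b)) ⊆ V(R). -/

import Mathlib

/-! ## Basic definitions: lattice polytopes, smooth Fano polytopes,
unimodular equivalence, F- and I-equivalence, primitive collections. -/

/-- A point of `ℝ^n` all of whose coordinates are integers. -/
def IsLatticePoint {n : ℕ} (x : Fin n → ℝ) : Prop := ∀ i, ∃ m : ℤ, x i = (m : ℝ)

/-- The vertex set of a polytope: its extreme points. -/
def vertexSet {n : ℕ} (P : Set (Fin n → ℝ)) : Set (Fin n → ℝ) :=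
  Set.extremePoints ℝ P

/-- A lattice `n`-polytope: the convex hull of finitely many lattice points,
of full dimension `n`. -/
def IsLatticePolytope {n : ℕ} (P : Set (Fin n → ℝ)) : Prop :=
  (∃ S : Finset (Fin n → ℝ), (∀ x ∈ S, IsLatticePoint x) ∧
    P = convexHull ℝ (S : Set (Fin n → ℝ))) ∧
  affineSpan ℝ P = ⊤

/-- A face of `P`: an exposed subset of `P`. -/
def IsFaceOf {n : ℕ} (F P : Set (Fin n → ℝ)) : Prop := IsExposed ℝ P F

/-- A facet of `P`: a face of affine dimension `n - 1`. -/
def IsFacetOf {n : ℕ} (F P : Set (Fin n → ℝ)) : Prop :=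
  IsFaceOf F P ∧ Module.finrank ℝ (vectorSpan ℝ F) + 1 = n

/-- A set `S` of points of `ℝ^n` forms a `ℤ`-basis of `ℤ^n`:
it consists of `n` lattice points whose matrix has determinant `±1`. -/
def IsUnimodularBasis {n : ℕ} (S : Set (Fin n → ℝ)) : Prop :=
  ∃ b : Fin n → (Fin n → ℝ), Function.Injective b ∧ Set.range b = S ∧
    (∀ i, IsLatticePoint (b i)) ∧ |(Matrix.of b).det| = 1

/-- A smooth Fano `n`-polytope: a lattice `n`-polytope with the origin in its
interior such that the vertex set of every facet is a `ℤ`-basis of `ℤ^n`. -/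
def IsSmoothFano {n : ℕ} (P : Set (Fin n → ℝ)) : Prop :=
  IsLatticePolytope P ∧ (0 : Fin n → ℝ) ∈ interior P ∧
    ∀ F : Set (Fin n → ℝ), IsFacetOf F P → IsUnimodularBasis (vertexSet P ∩ F)

/-- Two subsets of `ℝ^n` are unimodularly equivalent if an affine map of `ℝ^n`
mapping `ℤ^n` onto `ℤ^n` maps one onto the other. -/
def UnimodularEquiv {n : ℕ} (Q Q' : Set (Fin n → ℝ)) : Prop :=
  ∃ φ : (Fin n → ℝ) →ᵃ[ℝ] (Fin n → ℝ),
    φ '' {x | IsLatticePoint x} = {x | IsLatticePoint x} ∧ φ '' Q = Q'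

/-- One step of an I-sequence: the vertex set of one polytope is obtained from
the vertex set of the other by adding one new lattice point. -/
def IStep {n : ℕ} (P Q : Set (Fin n → ℝ)) : Prop :=
  (∃ w : Fin n → ℝ, IsLatticePoint w ∧ w ∉ vertexSet P ∧
    vertexSet Q = vertexSet P ∪ {w}) ∨
  (∃ w : Fin n → ℝ, IsLatticePoint w ∧ w ∉ vertexSet Q ∧
    vertexSet P = vertexSet Q ∪ {w})

/-- I-equivalence of smooth Fano `n`-polytopes. -/
def IEquiv {n : ℕ} (P Q : Set (Fin n → ℝ)) : Prop :=
  ∃ (k : ℕ) (c : Fin (k + 1) → Set (Fin n → ℝ)),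
    (∀ i, IsSmoothFano (c i)) ∧
    UnimodularEquiv P (c 0) ∧ UnimodularEquiv Q (c (Fin.last k)) ∧
    ∀ i : Fin k, IStep (c i.castSucc) (c i.succ)

/-- `Q` is the stellar subdivision of `P` at the new vertex `w`: `w` is the sum
of the vertices of a proper face `F` of `P`, and the facets of `Q` containing
`w` are exactly the sets `conv({w} ∪ (V(F') \ {v}))` for `F'` a facet of `P`
containing `F` and `v` a vertex of `F`. -/
def IsStellarSubdivisionAt {n : ℕ} (P Q : Set (Fin n → ℝ)) (w : Fin n → ℝ) : Prop :=
  ∃ F : Set (Fin n → ℝ), IsFaceOf F P ∧ F.Nonempty ∧ F ≠ P ∧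
    w = ∑ᶠ v ∈ vertexSet P ∩ F, v ∧
    {G : Set (Fin n → ℝ) | IsFacetOf G Q ∧ w ∈ G} =
      {G : Set (Fin n → ℝ) | ∃ F' v, IsFacetOf F' P ∧ F ⊆ F' ∧
        v ∈ vertexSet P ∩ F ∧
        G = convexHull ℝ (insert w ((vertexSet P ∩ F') \ {v}))}

/-- One step of an F-sequence: an I-step which moreover is a stellar
subdivision (or its inverse). -/
def FStep {n : ℕ} (P Q : Set (Fin n → ℝ)) : Prop :=
  (∃ w : Fin n → ℝ, IsLatticePoint w ∧ w ∉ vertexSet P ∧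
    vertexSet Q = vertexSet P ∪ {w} ∧ IsStellarSubdivisionAt P Q w) ∨
  (∃ w : Fin n → ℝ, IsLatticePoint w ∧ w ∉ vertexSet Q ∧
    vertexSet P = vertexSet Q ∪ {w} ∧ IsStellarSubdivisionAt Q P w)

/-- F-equivalence of smooth Fano `n`-polytopes. -/
def FEquiv {n : ℕ} (P Q : Set (Fin n → ℝ)) : Prop :=
  ∃ (k : ℕ) (c : Fin (k + 1) → Set (Fin n → ℝ)),
    (∀ i, IsSmoothFano (c i)) ∧
    UnimodularEquiv P (c 0) ∧ UnimodularEquiv Q (c (Fin.last k)) ∧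
    ∀ i : Fin k, FStep (c i.castSucc) (c i.succ)

/-- A smooth Fano polytope is F-isolated if every smooth Fano polytope
F-equivalent to it is unimodularly equivalent to it. -/
def FIsolated {n : ℕ} (P : Set (Fin n → ℝ)) : Prop :=
  ∀ Q : Set (Fin n → ℝ), IsSmoothFano Q → FEquiv Q P → UnimodularEquiv Q P

/-- A smooth Fano polytope is I-isolated if every smooth Fano polytope
I-equivalent to it is unimodularly equivalent to it. -/
def IIsolated {n : ℕ} (P : Set (Fin n → ℝ)) : Prop :=
  ∀ Q : Set (Fin n → ℝ), IsSmoothFano Q → IEquiv Q P → UnimodularEquiv Q P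

/-- A primitive collection of a smooth Fano polytope `P`: a nonempty set `A` of
vertices such that `conv(A)` is not a face of `P` but `conv(A \ {x})` is a face
of `P` for every `x ∈ A`. -/
def IsPrimitiveCollection {n : ℕ} (P A : Set (Fin n → ℝ)) : Prop :=
  A.Nonempty ∧ A ⊆ vertexSet P ∧ ¬ IsFaceOf (convexHull ℝ A) P ∧
    ∀ x ∈ A, IsFaceOf (convexHull ℝ (A \ {x})) P

/-- The standard basis vector `e_i` of `ℝ^n`. -/
def stdBasis {n : ℕ} (i : Fin n) : Fin n → ℝ := fun q => if q = i then 1 else 0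

/-- The polytope `T^n = conv{e_1, …, e_n, -(e_1 + ⋯ + e_n)}`,
corresponding to projective `n`-space. -/
def Tpoly (n : ℕ) : Set (Fin n → ℝ) :=
  convexHull ℝ (Set.range (stdBasis (n := n)) ∪ {fun _ => (-1 : ℝ)})

namespace Pab

/-! The concrete polytope `P(a,b)` of dimension `n = a + 2b - 1`, from the
proof of Theorem `pic3cha` (coordinates are `0`-based: the paper's `e_q` is
the standard basis vector at index `q - 1`). -/

/-- `v_i = e_i` for `1 ≤ i ≤ a-1`, and
`v_a = -e_1 - ⋯ - e_{a+2b-2} + (a+b-1) e_{a+2b-1}`. -/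
def v (a b : ℕ) (i : Fin a) : Fin (a + 2 * b - 1) → ℝ :=
  if i.val < a - 1 then fun q => if q.val = i.val then 1 else 0
  else fun q => if q.val = a + 2 * b - 2 then ((a + b - 1 : ℕ) : ℝ) else -1

/-- `y_j = e_{a-1+j}` for `1 ≤ j ≤ b-1`, and `y_b = e_{a+b-1} + ⋯ + e_{a+2b-2}`. -/
def y (a b : ℕ) (j : Fin b) : Fin (a + 2 * b - 1) → ℝ :=
  if j.val < b - 1 then fun q => if q.val = a - 1 + j.val then 1 else 0
  else fun q => if a + b - 2 ≤ q.val ∧ q.val ≤ a + 2 * b - 3 then 1 else 0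

/-- `z = -e_{a+2b-1}`. -/
def z (a b : ℕ) : Fin (a + 2 * b - 1) → ℝ :=
  fun q => if q.val = a + 2 * b - 2 then -1 else 0

/-- `t = e_{a+2b-1}`. -/
def t (a b : ℕ) : Fin (a + 2 * b - 1) → ℝ :=
  fun q => if q.val = a + 2 * b - 2 then 1 else 0

/-- `u_j = e_{a+b-1+j}` for `1 ≤ j ≤ b-1`, and
`u_b = e_a + ⋯ + e_{a+b-1} - e_{a+2b-1}`. -/
def u (a b : ℕ) (j : Fin b) : Fin (a + 2 * b - 1) → ℝ :=
  if j.val < b - 1 then fun q => if q.val = a + b - 1 + j.val then 1 else 0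
  else fun q => if a - 1 ≤ q.val ∧ q.val ≤ a + b - 2 then 1
    else if q.val = a + 2 * b - 2 then -1 else 0

/-- The polytope `P(a,b)`. -/
def P (a b : ℕ) : Set (Fin (a + 2 * b - 1) → ℝ) :=
  convexHull ℝ
    (Set.range (v a b) ∪ Set.range (y a b) ∪ {z a b, t a b} ∪ Set.range (u a b))

end Pab

/-! ## Facets of smooth Fano polytopes via linear functionals -/

/-- A unimodular set of `n` vectors is a basis of `ℝ^n` with respect to which all lattice points
have integral coordinates. -/
lemma IsUnimodularBasis.exists_basis {n : ℕ} {S : Set (Fin n → ℝ)} (h : IsUnimodularBasis S) :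
    ∃ B : Module.Basis (Fin n) ℝ (Fin n → ℝ), Set.range B = S ∧
      ∀ x, IsLatticePoint x → ∀ i, ∃ m : ℤ, B.repr x i = m := by
  obtain ⟨b, -, hrange, hlat, hdet⟩ := h
  choose M hM using hlat
  have hMb : Matrix.of b = (Matrix.of M).map (Int.cast : ℤ → ℝ) := by
    ext i j
    simp [hM]
  have hdetM : |(Matrix.of M).det| = 1 := by
    have h1 : (Matrix.of b).det = (((Matrix.of M).det : ℤ) : ℝ) := by
      rw [hMb]
      exact (Int.cast_det (Matrix.of M)).symm
    rw [h1] at hdet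
    exact_mod_cast hdet
  have hunit : IsUnit (Matrix.of M).det := Int.isUnit_iff_abs_eq.2 hdetM
  have hli : LinearIndependent ℝ b := by
    have : IsUnit (Matrix.of b).det := by
      rw [isUnit_iff_ne_zero]
      intro h0
      simp [h0] at hdet
    exact Matrix.linearIndependent_rows_of_isUnit ((Matrix.isUnit_iff_isUnit_det _).2 this)
  let B := basisOfLinearIndependentOfCardEqFinrank' b hli (by simp)
  have hB : ⇑B = b := coe_basisOfLinearIndependentOfCardEqFinrank' b hli (by simp)
  refine ⟨B, by rw [hB, hrange], fun x hx i => ?_⟩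
  choose m hm using hx
  refine ⟨Matrix.vecMul m (Matrix.of M)⁻¹ i, ?_⟩
  have hsum : x = ∑ i, ((Matrix.vecMul m (Matrix.of M)⁻¹ i : ℤ) : ℝ) • B i := by
    have h2 : Matrix.vecMul (Matrix.vecMul m (Matrix.of M)⁻¹) (Matrix.of M) = m := by
      rw [Matrix.vecMul_vecMul, Matrix.nonsing_inv_mul _ hunit, Matrix.vecMul_one]
    ext q
    rw [hm q, ← congrFun h2 q, hB]
    simp [Matrix.vecMul, dotProduct, hM]
  conv_lhs => rw [hsum]
  rw [B.repr_sum_self]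

/-- A linear functional defining a facet of the polytope with vertex set `V` at height one. -/
def IsFacetFunctional {n : ℕ} (V : Set (Fin n → ℝ)) (l : Module.Dual ℝ (Fin n → ℝ)) : Prop :=
  (∀ x ∈ V, l x ≤ 1) ∧ Submodule.span ℝ {x ∈ V | l x = 1} = ⊤

lemma le_of_mem_convexHull {n : ℕ} {V : Set (Fin n → ℝ)} {l : Module.Dual ℝ (Fin n → ℝ)} {c : ℝ}
    (h : ∀ x ∈ V, l x ≤ c) {x : Fin n → ℝ} (hx : x ∈ convexHull ℝ V) : l x ≤ c :=
  convexHull_min (t := {x | l x ≤ c}) h (convex_halfSpace_le l.isLinear c) hx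

lemma exists_pos_smul_mem_of_zero_mem_interior {n : ℕ} {R : Set (Fin n → ℝ)}
    (h0 : (0 : Fin n → ℝ) ∈ interior R) (x : Fin n → ℝ) : ∃ ε : ℝ, 0 < ε ∧ ε • x ∈ R := by
  have hc : Filter.Tendsto (fun ε : ℝ => ε • x) (nhdsWithin 0 (Set.Ioi 0)) (nhds 0) := by
    have : Continuous fun ε : ℝ => ε • x := by fun_prop
    have := this.tendsto 0
    rw [zero_smul] at this
    exact this.mono_left nhdsWithin_le_nhds
  have h1 := hc.eventually (mem_interior_iff_mem_nhds.1 h0)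
  have h2 := h1.and self_mem_nhdsWithin
  obtain ⟨ε, hε, hpos⟩ := h2.exists
  exact ⟨ε, hpos, hε⟩

lemma exists_pos_of_zero_mem_interior {n : ℕ} {V : Set (Fin n → ℝ)}
    (h0 : (0 : Fin n → ℝ) ∈ interior (convexHull ℝ V)) {g : Module.Dual ℝ (Fin n → ℝ)}
    (hg : g ≠ 0) : ∃ x ∈ V, 0 < g x := by
  by_contra! hneg
  refine hg (LinearMap.ext fun x => ?_)
  have key : ∀ x, g x ≤ 0 := by
    intro x
    obtain ⟨ε, hε, hmem⟩ := exists_pos_smul_mem_of_zero_mem_interior h0 x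
    have := le_of_mem_convexHull hneg hmem
    rw [map_smul, smul_eq_mul] at this
    exact nonpos_of_mul_nonpos_right this hε
  have h2 := key (-x)
  rw [map_neg] at h2
  rw [LinearMap.zero_apply]
  linarith [key x]

/-- Tilting a supporting functional in a direction until it touches a further vertex. -/
lemma exists_tilt {n : ℕ} {V : Set (Fin n → ℝ)} (hV : V.Finite)
    (h0 : (0 : Fin n → ℝ) ∈ interior (convexHull ℝ V)) {l g : Module.Dual ℝ (Fin n → ℝ)}
    (hl : ∀ x ∈ V, l x ≤ 1) (hg : g ≠ 0) (hgl : ∀ x ∈ V, l x = 1 → g x ≤ 0) :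
    ∃ θ : ℝ, 0 < θ ∧ (∀ x ∈ V, (l + θ • g) x ≤ 1) ∧
      ∃ x ∈ V, 0 < g x ∧ (l + θ • g) x = 1 := by
  obtain ⟨x₀, hx₀, hgx₀⟩ := exists_pos_of_zero_mem_interior h0 hg
  obtain ⟨x, ⟨hxV, hgx⟩, hmin⟩ := Set.exists_min_image {x ∈ V | 0 < g x}
    (fun x => (1 - l x) / g x) (hV.subset (Set.sep_subset _ _)) ⟨x₀, hx₀, hgx₀⟩
  have hlx : l x < 1 := lt_of_le_of_ne (hl x hxV) fun h => absurd (hgl x hxV h) (not_le.2 hgx)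
  have hθ : 0 < (1 - l x) / g x := div_pos (by linarith) hgx
  refine ⟨(1 - l x) / g x, hθ, fun y hy => ?_, x, hxV, hgx, ?_⟩
  · simp only [LinearMap.add_apply, LinearMap.smul_apply, smul_eq_mul]
    rcases le_or_gt (g y) 0 with h | h
    · have := mul_nonpos_of_nonneg_of_nonpos hθ.le h
      linarith [hl y hy]
    · have := (le_div_iff₀ h).1 (hmin y ⟨hy, h⟩)
      linarith
  · simp only [LinearMap.add_apply, LinearMap.smul_apply, smul_eq_mul]
    rw [div_mul_cancel₀ _ hgx.ne']
    ring

/-- Crossing the ridge opposite to the vertex `x` of a facet. -/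
lemma IsFacetFunctional.exists_adjacent {n : ℕ} {V : Set (Fin n → ℝ)} (hV : V.Finite)
    (h0 : (0 : Fin n → ℝ) ∈ interior (convexHull ℝ V)) {l : Module.Dual ℝ (Fin n → ℝ)}
    (hl : IsFacetFunctional V l) (hbasis : IsUnimodularBasis {x ∈ V | l x = 1})
    {x : Fin n → ℝ} (hx : x ∈ V) (hlx : l x = 1) :
    ∃ l', IsFacetFunctional V l' ∧ l' x < 1 ∧ ∀ y ∈ V, y ≠ x → l y = 1 → l' y = 1 := by
  obtain ⟨B, hB, -⟩ := hbasis.exists_basis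
  obtain ⟨i, rfl⟩ : x ∈ Set.range B := by rw [hB]; exact ⟨hx, hlx⟩
  have hcoord : ∀ y ∈ V, y ≠ B i → l y = 1 → B.coord i y = 0 := by
    intro y hy hne hly
    obtain ⟨k, rfl⟩ : y ∈ Set.range B := by rw [hB]; exact ⟨hy, hly⟩
    have : k ≠ i := fun h => hne (by rw [h])
    simp [this]
  obtain ⟨θ, hθ, hle, v, hv, hgv, hlv⟩ := exists_tilt hV h0 (g := -B.coord i) hl.1
    (fun h => by
      have := congrArg (fun f => f (B i)) h
      simp at this)
    (fun y hy hly => by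
      by_cases hyx : y = B i
      · simp [hyx]
      · simp [-Module.Basis.coord_apply, hcoord y hy hyx hly])
  have hone : ∀ y ∈ V, y ≠ B i → l y = 1 → (l + θ • -B.coord i) y = 1 := by
    intro y hy hne hly
    simp [-Module.Basis.coord_apply, hcoord y hy hne hly, hly]
  refine ⟨l + θ • -B.coord i, ⟨hle, ?_⟩, ?_, hone⟩
  · set W := Submodule.span ℝ {x ∈ V | (l + θ • -B.coord i) x = 1} with hW
    have hk : ∀ k, k ≠ i → B k ∈ W := by
      intro k hki
      have hmem : B k ∈ {x ∈ V | l x = 1} := hB ▸ Set.mem_range_self k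
      exact Submodule.subset_span
        ⟨hmem.1, hone _ hmem.1 (fun h => hki (B.injective h)) hmem.2⟩
    have hvW : v ∈ W := Submodule.subset_span ⟨hv, hlv⟩
    have hiW : B i ∈ W := by
      have hsum := B.sum_repr v
      rw [← Finset.add_sum_erase _ _ (Finset.mem_univ i)] at hsum
      have hrest : ∑ k ∈ Finset.univ.erase i, B.repr v k • B k ∈ W :=
        Submodule.sum_mem _ fun k hk' => W.smul_mem _ (hk k (Finset.ne_of_mem_erase hk'))
      have h1 : B.repr v i • B i ∈ W := by
        rw [eq_sub_of_add_eq hsum]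
        exact W.sub_mem hvW hrest
      have hne : B.repr v i ≠ 0 := by
        simp only [LinearMap.neg_apply, Module.Basis.coord_apply] at hgv
        linarith
      exact (W.smul_mem_iff hne).1 h1
    rw [eq_top_iff, ← B.span_eq, Submodule.span_le]
    rintro _ ⟨k, rfl⟩
    by_cases hki : k = i
    · rw [hki]; exact hiW
    · exact hk k hki
  · simp [hlx, hθ]

/-- Every supporting functional can be tilted, keeping its contact points, to a facet. -/
lemma exists_isFacetFunctional_of_le_one {n : ℕ} {V : Set (Fin n → ℝ)} (hV : V.Finite)
    (h0 : (0 : Fin n → ℝ) ∈ interior (convexHull ℝ V)) {x : Fin n → ℝ}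
    {l : Module.Dual ℝ (Fin n → ℝ)} (hl : ∀ y ∈ V, l y ≤ 1) (hlx : l x = 1) (hx : x ∈ V) :
    ∃ l', IsFacetFunctional V l' ∧ l' x = 1 := by
  induction hd : n - Module.finrank ℝ (Submodule.span ℝ {y ∈ V | l y = 1})
    using Nat.strong_induction_on generalizing l with
  | _ d ih =>
    by_cases htop : Submodule.span ℝ {y ∈ V | l y = 1} = ⊤
    · exact ⟨l, ⟨hl, htop⟩, hlx⟩
    obtain ⟨g, hg, hgker⟩ := Submodule.exists_le_ker_of_lt_top _ (lt_top_iff_ne_top.2 htop)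
    have hg0 : ∀ y ∈ V, l y = 1 → g y = 0 := fun y hy hly =>
      hgker (Submodule.subset_span ⟨hy, hly⟩)
    obtain ⟨θ, hθ, hle, v, hv, hgv, hlv⟩ := exists_tilt hV h0 hl hg
      fun y hy hly => (hg0 y hy hly).le
    have hone : ∀ y ∈ V, l y = 1 → (l + θ • g) y = 1 := by
      intro y hy hly
      simp [hg0 y hy hly, hly]
    refine ih _ ?_ hle (hone x hx hlx) rfl
    rw [← hd]
    have hlt : Submodule.span ℝ {y ∈ V | l y = 1} <
        Submodule.span ℝ {y ∈ V | (l + θ • g) y = 1} := by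
      refine lt_of_le_of_ne (Submodule.span_mono fun y hy => ⟨hy.1, hone y hy.1 hy.2⟩) ?_
      intro heq
      have : v ∈ Submodule.span ℝ {y ∈ V | l y = 1} :=
        heq ▸ Submodule.subset_span ⟨hv, hlv⟩
      have h2 : g v = 0 := hgker this
      exact hgv.ne' h2
    have h1 := Submodule.finrank_lt_finrank_of_lt hlt
    have h2 := Submodule.finrank_le (Submodule.span ℝ {y ∈ V | (l + θ • g) y = 1})
    rw [Module.finrank_fin_fun] at h2
    omega

/-- Every vertex of a polytope with the origin in its interior lies on a facet. -/
lemma exists_isFacetFunctional_of_mem_vertexSet {n : ℕ} {R : Set (Fin n → ℝ)}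
    (hn : 0 < n) (hV : (vertexSet R).Finite) (hR : R = convexHull ℝ (vertexSet R))
    (h0 : (0 : Fin n → ℝ) ∈ interior R) {x : Fin n → ℝ} (hx : x ∈ vertexSet R) :
    ∃ l, IsFacetFunctional (vertexSet R) l ∧ l x = 1 := by
  have hconv : Convex ℝ R := hR ▸ convex_convexHull ℝ _
  have : Nonempty (Fin n) := ⟨⟨0, hn⟩⟩
  have hxint : x ∉ interior R := fun h =>
    Set.disjoint_left.1 (disjoint_interior_extremePoints R) h hx
  obtain ⟨f, hf⟩ := geometric_hahn_banach_open_point hconv.interior isOpen_interior hxint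
  have hpos : 0 < f x := by simpa using hf 0 h0
  have hle : ∀ y ∈ R, f y ≤ f x := by
    intro y hy
    have hycl : y ∈ closure (interior R) := by
      rw [hconv.closure_interior_eq_closure_of_nonempty_interior ⟨0, h0⟩]
      exact subset_closure hy
    exact closure_minimal (fun z hz => (hf z hz).le)
      (isClosed_le f.continuous continuous_const) hycl
  refine exists_isFacetFunctional_of_le_one hV (hR ▸ h0)
    (l := (f x)⁻¹ • (f : (Fin n → ℝ) →ₗ[ℝ] ℝ)) (fun y hy => ?_) ?_ hx
  · have := hle y (extremePoints_subset hy)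
    simpa [inv_mul_le_iff₀ hpos] using this
  · simp [hpos.ne']

/-- A facet functional cuts out a facet. -/
lemma IsFacetFunctional.isFacetOf {n : ℕ} {R : Set (Fin n → ℝ)}
    (hR : R = convexHull ℝ (vertexSet R)) (hn : 0 < n) {l : Module.Dual ℝ (Fin n → ℝ)}
    (hl : IsFacetFunctional (vertexSet R) l) : IsFacetOf {x ∈ R | l x = 1} R := by
  have hle : ∀ x ∈ R, l x ≤ 1 := fun x hx => le_of_mem_convexHull hl.1 (hR ▸ hx)
  have hVR : vertexSet R ⊆ R := extremePoints_subset
  have hne : {x ∈ vertexSet R | l x = 1}.Nonempty := by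
    rw [Set.nonempty_iff_ne_empty]
    intro h
    have h1 := hl.2
    rw [h, Submodule.span_empty] at h1
    have h2 := congrArg (fun W : Submodule ℝ (Fin n → ℝ) => Module.finrank ℝ W) h1
    simp at h2
    omega
  obtain ⟨x₀, hx₀V, hx₀⟩ := hne
  refine ⟨fun _ => ⟨LinearMap.toContinuousLinearMap l, ?_⟩, ?_⟩
  · ext x
    simp only [Set.mem_ofPred_eq, LinearMap.coe_toContinuousLinearMap']
    refine and_congr_right fun hx => ⟨fun h y hy => h ▸ hle y hy, fun h => ?_⟩
    exact le_antisymm (hle x hx) (hx₀ ▸ h x₀ (hVR hx₀V))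
  · have hker : vectorSpan ℝ {x ∈ R | l x = 1} = LinearMap.ker l := by
      apply le_antisymm
      · rw [vectorSpan, Submodule.span_le]
        rintro _ ⟨x, hx, y, hy, rfl⟩
        simp [hx.2, hy.2]
      · have key : ∀ x ∈ Submodule.span ℝ {x ∈ vertexSet R | l x = 1},
            x - l x • x₀ ∈ vectorSpan ℝ {x ∈ R | l x = 1} := by
          intro x hx
          induction hx using Submodule.span_induction with
          | mem x hx =>
            rw [hx.2, one_smul]
            exact vsub_mem_vectorSpan ℝ (s := {x ∈ R | l x = 1}) ⟨hVR hx.1, hx.2⟩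
              ⟨hVR hx₀V, hx₀⟩
          | zero => simp
          | add x y _ _ hx hy =>
            have := Submodule.add_mem _ hx hy
            convert this using 1
            rw [map_add, add_smul]
            abel
          | smul c x _ hx =>
            have := Submodule.smul_mem _ c hx
            convert this using 1
            rw [map_smul, smul_sub, smul_smul, smul_eq_mul]
        intro x hx
        have := key x (hl.2 ▸ Submodule.mem_top)
        rwa [LinearMap.mem_ker.1 hx, zero_smul, sub_zero] at this
    have hsurj : LinearMap.range l = ⊤ :=
      LinearMap.range_eq_top.2 (LinearMap.surjective fun h => by simp [h] at hx₀)
    have := LinearMap.finrank_range_add_finrank_ker l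
    rw [hsurj, finrank_top, Module.finrank_self, Module.finrank_fin_fun] at this
    rw [hker]
    omega

/-- The vertices of a lattice polytope are finitely many lattice points spanning it. -/
lemma IsLatticePolytope.vertexSet_spec {n : ℕ} {R : Set (Fin n → ℝ)} (h : IsLatticePolytope R) :
    (vertexSet R).Finite ∧ (∀ x ∈ vertexSet R, IsLatticePoint x) ∧
      R = convexHull ℝ (vertexSet R) := by
  obtain ⟨⟨S, hlat, rfl⟩, -⟩ := h
  have hsub : vertexSet (convexHull ℝ (S : Set (Fin n → ℝ))) ⊆ S := extremePoints_convexHull_subset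
  have hfin := S.finite_toSet.subset hsub
  refine ⟨hfin, fun x hx => hlat x (hsub hx), ?_⟩
  exact (closure_convexHull_extremePoints (S.finite_toSet.isCompact_convexHull ℝ)
    (convex_convexHull ℝ _)).symm.trans (hfin.isClosed_convexHull ℝ).closure_eq

lemma IsSmoothFano.isUnimodularBasis {n : ℕ} {R : Set (Fin n → ℝ)} (h : IsSmoothFano R)
    (hn : 0 < n) {l : Module.Dual ℝ (Fin n → ℝ)} (hl : IsFacetFunctional (vertexSet R) l) :
    IsUnimodularBasis {x ∈ vertexSet R | l x = 1} := by
  convert h.2.2 _ (hl.isFacetOf h.1.vertexSet_spec.2.2 hn) using 1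
  ext x
  exact ⟨fun hx => ⟨hx.1, extremePoints_subset hx.1, hx.2⟩, fun hx => ⟨hx.1, hx.2.2⟩⟩

/-! ## Integer sums of terms bounded by one -/

lemma sum_mul_eq_of_eq_one {m : ℕ} {f : Fin m → ℤ} (c : Fin m → ℤ) {i : Fin m}
    (h : ∀ l ≠ i, f l = 1) : ∑ l, c l * f l = ∑ l, c l + c i * (f i - 1) := by
  rw [← Finset.add_sum_erase _ _ (Finset.mem_univ i), ← Finset.add_sum_erase _ c
    (Finset.mem_univ i), Finset.sum_congr rfl fun l hl => by
      rw [h l (Finset.ne_of_mem_erase hl), mul_one]]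
  ring

lemma sum_eq_of_eq_one {m : ℕ} {f : Fin m → ℤ} {i : Fin m} (h : ∀ l ≠ i, f l = 1) :
    ∑ l, f l = m - 1 + f i := by
  have := sum_mul_eq_of_eq_one (fun _ => 1) h
  simp only [one_mul, Finset.sum_const, Finset.card_univ, Fintype.card_fin, nsmul_eq_mul,
    mul_one] at this
  linarith

lemma sum_le_of_le_one {m : ℕ} {f : Fin m → ℤ} (h : ∀ l, f l ≤ 1) : ∑ l, f l ≤ m := by
  simpa using Finset.sum_le_sum fun l (_ : l ∈ Finset.univ) => h l

lemma eq_one_of_le_sum {m : ℕ} {f : Fin m → ℤ} (h : ∀ l, f l ≤ 1) (hs : (m : ℤ) ≤ ∑ l, f l)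
    (i : Fin m) : f i = 1 := by
  have h1 := (Finset.sum_eq_sum_iff_of_le (g := fun _ => (1 : ℤ))
    fun l (_ : l ∈ Finset.univ) => h l).1 (le_antisymm (by simpa using sum_le_of_le_one h)
      (by simpa using hs))
  exact h1 i (Finset.mem_univ i)

lemma eq_one_of_sub_one_le_sum {m : ℕ} {f : Fin m → ℤ} (h : ∀ l, f l ≤ 1) {i : Fin m}
    (hi : f i ≤ 0) (hs : (m : ℤ) - 1 ≤ ∑ l, f l) : f i = 0 ∧ ∀ l ≠ i, f l = 1 := by
  have key : ∀ l, Function.update f i (f i + 1) l = 1 := by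
    refine eq_one_of_le_sum (fun l => ?_) ?_
    · by_cases hl : l = i
      · subst hl; simp; omega
      · simp [hl, h]
    · rw [Finset.sum_update_of_mem (Finset.mem_univ i), ← Finset.erase_eq, add_right_comm,
        Finset.add_sum_erase _ _ (Finset.mem_univ i)]
      linarith
  refine ⟨?_, fun l hl => ?_⟩
  · have := key i
    simp at this
    exact this
  · have := key l
    rwa [Function.update_of_ne hl] at this

namespace Pab

/-! ## The combinatorics of facets of a superpolytope of `P(a,b)` -/

/-- Labels of the vertices of `P(a,b)` together with one additional point. -/
abbrev Idx (a b : ℕ) : Type := Fin a ⊕ Fin b ⊕ Fin b ⊕ Fin 3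

namespace Idx

variable {a b : ℕ}

/-- The label of `v_i`. -/
abbrev v (i : Fin a) : Idx a b := Sum.inl i

/-- The label of `y_j`. -/
abbrev y (j : Fin b) : Idx a b := Sum.inr (Sum.inl j)

/-- The label of `u_j`. -/
abbrev u (j : Fin b) : Idx a b := Sum.inr (Sum.inr (Sum.inl j))

/-- The label of `z`. -/
abbrev z : Idx a b := Sum.inr (Sum.inr (Sum.inr 0))

/-- The label of `t`. -/
abbrev t : Idx a b := Sum.inr (Sum.inr (Sum.inr 1))

/-- The label of the additional point. -/
abbrev w : Idx a b := Sum.inr (Sum.inr (Sum.inr 2))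

end Idx

/-- The properties, used below, of the set of all height vectors `k ↦ ⟨l, p k⟩` of the facets of a
smooth Fano polytope with vertices `p k`, where `k` ranges over the labels in `Idx a b`. -/
structure IsFacetSystem {a b : ℕ} (Φ : Set (Idx a b → ℤ)) : Prop where
  le_one : ∀ f ∈ Φ, ∀ k, f k ≤ 1
  z_eq : ∀ f ∈ Φ, f .z = -f .t
  u_sum : ∀ f ∈ Φ, ∑ j, f (.u j) + f .t = ∑ j, f (.y j)
  v_sum : ∀ f ∈ Φ, ∑ i, f (.v i) + ∑ j, f (.y j) = (a + b - 1) * f .t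
  card_ne_one : ∀ f ∈ Φ, (Finset.univ.filter fun k => f k ≠ 1).card = 4
  adjacent : ∀ f ∈ Φ, ∀ k, f k = 1 → ∃ g ∈ Φ, g k ≤ 0 ∧ ∀ m ≠ k, f m = 1 → g m = 1
  exists_eq_one : ∀ k, ∃ f ∈ Φ, f k = 1
  coords : ∀ f ∈ Φ, ∃ c : Idx a b → ℤ, (∀ k, f k ≠ 1 → c k = 0) ∧
    ∀ g ∈ Φ, g .w = ∑ k, c k * g k

namespace IsFacetSystem

variable {a b : ℕ} {Φ : Set (Idx a b → ℤ)}

lemma nonpos_of_forall_eq_one (hΦ : IsFacetSystem Φ) {f : Idx a b → ℤ} (hf : f ∈ Φ)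
    {p q r s : Idx a b} (h : ∀ k, k ≠ p → k ≠ q → k ≠ r → k ≠ s → f k = 1) : f s ≤ 0 := by
  have hsub : (Finset.univ.filter fun k => f k ≠ 1) ⊆ {p, q, r, s} := by
    intro k hk
    by_contra hk'
    simp only [Finset.mem_insert, Finset.mem_singleton, not_or] at hk'
    exact (Finset.mem_filter.1 hk).2 (h k hk'.1 hk'.2.1 hk'.2.2.1 hk'.2.2.2)
  have heq := Finset.eq_of_subset_of_card_le hsub
    (by rw [hΦ.card_ne_one f hf]; exact Finset.card_le_four)
  have hs : s ∈ Finset.univ.filter fun k => f k ≠ 1 := by rw [heq]; simp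
  have := (Finset.mem_filter.1 hs).2
  have := hΦ.le_one f hf s
  omega

lemma eq_one_of_four (hΦ : IsFacetSystem Φ) {f : Idx a b → ℤ} (hf : f ∈ Φ)
    {p q r s k : Idx a b} (hcard : ({p, q, r, s} : Finset (Idx a b)).card = 4)
    (hp : f p ≠ 1) (hq : f q ≠ 1) (hr : f r ≠ 1) (hs : f s ≠ 1)
    (hk : k ∉ ({p, q, r, s} : Finset (Idx a b))) : f k = 1 := by
  have hsub : ({p, q, r, s} : Finset (Idx a b)) ⊆ Finset.univ.filter fun k => f k ≠ 1 := by
    intro k hk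
    simp only [Finset.mem_insert, Finset.mem_singleton] at hk
    rcases hk with rfl | rfl | rfl | rfl <;> simpa
  have heq := Finset.eq_of_subset_of_card_le hsub (by rw [hΦ.card_ne_one f hf, hcard])
  rw [heq] at hk
  simpa using hk

lemma le_one_v (hΦ : IsFacetSystem Φ) {f : Idx a b → ℤ} (hf : f ∈ Φ) (i : Fin a) :
    f (.v i) ≤ 1 := hΦ.le_one f hf _

lemma le_one_y (hΦ : IsFacetSystem Φ) {f : Idx a b → ℤ} (hf : f ∈ Φ) (j : Fin b) :
    f (.y j) ≤ 1 := hΦ.le_one f hf _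

lemma le_one_u (hΦ : IsFacetSystem Φ) {f : Idx a b → ℤ} (hf : f ∈ Φ) (j : Fin b) :
    f (.u j) ≤ 1 := hΦ.le_one f hf _

/-- The facet through `t` that misses `v_i` and `u_k`. -/
structure IsFacetTVU (Φ : Set (Idx a b → ℤ)) (i : Fin a) (k : Fin b) (f : Idx a b → ℤ) :
    Prop where
  mem : f ∈ Φ
  t : f .t = 1
  v : ∀ l ≠ i, f (.v l) = 1
  y : ∀ l, f (.y l) = 1
  u : ∀ l ≠ k, f (.u l) = 1

/-- The facet through `t` that misses `y_j` and `u_k`. -/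
structure IsFacetTYU (Φ : Set (Idx a b → ℤ)) (j k : Fin b) (f : Idx a b → ℤ) : Prop where
  mem : f ∈ Φ
  t : f .t = 1
  v : ∀ l, f (.v l) = 1
  y : ∀ l ≠ j, f (.y l) = 1
  y_self : f (.y j) = 0
  u : ∀ l ≠ k, f (.u l) = 1
  u_self : f (.u k) = -1

/-- The facet through neither `t` nor `z` that misses `v_i`. -/
structure IsFacetV (Φ : Set (Idx a b → ℤ)) (i : Fin a) (f : Idx a b → ℤ) : Prop where
  mem : f ∈ Φ
  t : f .t = 0
  v : ∀ l ≠ i, f (.v l) = 1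
  v_self : f (.v i) = -b - (a - 1)
  y : ∀ l, f (.y l) = 1
  u : ∀ l, f (.u l) = 1

/-- The facet through `z` that misses `v_i` and `y_j`. -/
structure IsFacetZVY (Φ : Set (Idx a b → ℤ)) (i : Fin a) (j : Fin b) (f : Idx a b → ℤ) :
    Prop where
  mem : f ∈ Φ
  z : f .z = 1
  v : ∀ l ≠ i, f (.v l) = 1
  y : ∀ l ≠ j, f (.y l) = 1
  u : ∀ l, f (.u l) = 1

/-- The facet through `z` that misses `y_j` and `u_k`. -/
structure IsFacetZYU (Φ : Set (Idx a b → ℤ)) (j k : Fin b) (f : Idx a b → ℤ) : Prop where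
  mem : f ∈ Φ
  z : f .z = 1
  v : ∀ l, f (.v l) = 1
  y : ∀ l ≠ j, f (.y l) = 1
  u : ∀ l ≠ k, f (.u l) = 1

lemma exists_isFacetTVU_of_v_ne_one (hΦ : IsFacetSystem Φ) {f : Idx a b → ℤ} (hf : f ∈ Φ)
    (ht : f .t = 1) {i : Fin a} (hi : f (.v i) ≠ 1) : ∃ k, IsFacetTVU Φ i k f := by
  have h1 := hΦ.v_sum f hf
  have h2 := hΦ.u_sum f hf
  rw [ht] at h1 h2
  have hY := sum_le_of_le_one (hΦ.le_one_y hf)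
  have hi' : f (.v i) ≤ 0 := by have := hΦ.le_one_v hf i; omega
  obtain ⟨hi0, hv⟩ := eq_one_of_sub_one_le_sum (hΦ.le_one_v hf) hi' (by linarith)
  have hV := sum_eq_of_eq_one hv
  have hy := eq_one_of_le_sum (hΦ.le_one_y hf) (by linarith)
  obtain ⟨k, hk⟩ : ∃ k, f (.u k) ≠ 1 := by
    by_contra! hall
    simp only [hall, hy, Finset.sum_const, Finset.card_univ, Fintype.card_fin, nsmul_eq_mul,
      mul_one] at h2
    omega
  have hk' : f (.u k) ≤ 0 := by have := hΦ.le_one_u hf k; omega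
  obtain ⟨hk0, hu⟩ := eq_one_of_sub_one_le_sum (hΦ.le_one_u hf) hk' (by linarith)
  exact ⟨k, hf, ht, hv, hy, hu⟩

lemma exists_isFacetTVU (hΦ : IsFacetSystem Φ) (ha : 0 < a) : ∃ i k f, IsFacetTVU Φ i k f := by
  obtain ⟨f, hf, ht⟩ := hΦ.exists_eq_one .t
  by_cases h : f (.v ⟨0, ha⟩) = 1
  · obtain ⟨g, hg, hgv, hone⟩ := hΦ.adjacent f hf _ h
    obtain ⟨k, hk⟩ := hΦ.exists_isFacetTVU_of_v_ne_one hg (hone _ (by simp) ht)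
      (i := ⟨0, ha⟩) (by omega)
    exact ⟨_, k, g, hk⟩
  · obtain ⟨k, hk⟩ := hΦ.exists_isFacetTVU_of_v_ne_one hf ht h
    exact ⟨_, k, f, hk⟩

lemma IsFacetTVU.exchange_v (hΦ : IsFacetSystem Φ) {i : Fin a} {k : Fin b} {f : Idx a b → ℤ}
    (h : IsFacetTVU Φ i k f) (l : Fin a) : ∃ g, IsFacetTVU Φ l k g := by
  by_cases hl : l = i
  · exact ⟨f, hl ▸ h⟩
  obtain ⟨g, hg, hgl, hone⟩ := hΦ.adjacent f h.mem _ (h.v l hl)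
  have hgt : g .t = 1 := hone _ (by simp) h.t
  have hgy : ∀ m, g (.y m) = 1 := fun m => hone _ (by simp) (h.y m)
  have h1 := hΦ.v_sum g hg
  simp only [hgt, hgy, Finset.sum_const, Finset.card_univ, Fintype.card_fin, nsmul_eq_mul,
      mul_one] at h1
  exact ⟨g, hg, hgt, (eq_one_of_sub_one_le_sum (hΦ.le_one_v hg) hgl (by linarith)).2, hgy,
    fun m hm => hone _ (by simp) (h.u m hm)⟩

lemma IsFacetTVU.exchange_u (hΦ : IsFacetSystem Φ) {i : Fin a} {k : Fin b} {f : Idx a b → ℤ}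
    (h : IsFacetTVU Φ i k f) (l : Fin b) : ∃ g, IsFacetTVU Φ i l g := by
  by_cases hl : l = k
  · exact ⟨f, hl ▸ h⟩
  obtain ⟨g, hg, hgl, hone⟩ := hΦ.adjacent f h.mem _ (h.u l hl)
  have hgt : g .t = 1 := hone _ (by simp) h.t
  have hgy : ∀ m, g (.y m) = 1 := fun m => hone _ (by simp) (h.y m)
  have h1 := hΦ.u_sum g hg
  simp only [hgt, hgy, Finset.sum_const, Finset.card_univ, Fintype.card_fin, nsmul_eq_mul,
      mul_one] at h1
  exact ⟨g, hg, hgt, fun m hm => hone _ (by simp) (h.v m hm), hgy,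
    (eq_one_of_sub_one_le_sum (hΦ.le_one_u hg) hgl (by linarith)).2⟩

lemma exists_facetTVU (hΦ : IsFacetSystem Φ) (ha : 0 < a) (i : Fin a) (k : Fin b) :
    ∃ f, IsFacetTVU Φ i k f := by
  obtain ⟨_, _, _, h⟩ := hΦ.exists_isFacetTVU ha
  obtain ⟨_, h⟩ := h.exchange_v hΦ i
  exact h.exchange_u hΦ k

lemma exists_facetTYU (hΦ : IsFacetSystem Φ) (ha : 0 < a) (j k : Fin b) :
    ∃ f, IsFacetTYU Φ j k f := by
  obtain ⟨f, h⟩ := hΦ.exists_facetTVU ha ⟨0, ha⟩ k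
  obtain ⟨g, hg, hgj, hone⟩ := hΦ.adjacent f h.mem _ (h.y j)
  have hgt : g .t = 1 := hone _ (by simp) h.t
  have hgy : ∀ m ≠ j, g (.y m) = 1 := fun m hm => hone _ (by simpa using hm) (h.y m)
  have hgu : ∀ m ≠ k, g (.u m) = 1 := fun m hm => hone _ (by simp) (h.u m hm)
  have h1 := hΦ.v_sum g hg
  have h2 := hΦ.u_sum g hg
  rw [sum_eq_of_eq_one hgy, hgt] at h1 h2
  rw [sum_eq_of_eq_one hgu] at h2
  have hV := sum_le_of_le_one (hΦ.le_one_v hg)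
  exact ⟨g, hg, hgt, eq_one_of_le_sum (hΦ.le_one_v hg) (by linarith), hgy, by linarith, hgu,
    by linarith⟩

lemma exists_facetV (hΦ : IsFacetSystem Φ) (hb : 0 < b) (i : Fin a) :
    ∃ f, IsFacetV Φ i f := by
  obtain ⟨f, h⟩ := hΦ.exists_facetTVU i.pos i ⟨0, hb⟩
  obtain ⟨g, hg, hgt, hone⟩ := hΦ.adjacent f h.mem _ h.t
  have hgv : ∀ m ≠ i, g (.v m) = 1 := fun m hm => hone _ (by simp) (h.v m hm)
  have hgy : ∀ m, g (.y m) = 1 := fun m => hone _ (by simp) (h.y m)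
  have h1 := hΦ.v_sum g hg
  have h2 := hΦ.u_sum g hg
  rw [sum_eq_of_eq_one hgv] at h1
  simp only [hgy, Finset.sum_const, Finset.card_univ, Fintype.card_fin, nsmul_eq_mul,
      mul_one] at h1 h2
  have hU := sum_le_of_le_one (hΦ.le_one_u hg)
  have ht : g .t = 0 := by linarith
  rw [ht] at h1 h2
  exact ⟨g, hg, ht, hgv, by linarith, hgy, eq_one_of_le_sum (hΦ.le_one_u hg) (by linarith)⟩

lemma exists_facetZVY (hΦ : IsFacetSystem Φ) (i : Fin a) (j : Fin b) :
    ∃ f, IsFacetZVY Φ i j f := by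
  obtain ⟨f, h⟩ := hΦ.exists_facetV j.pos i
  obtain ⟨g, hg, hgj, hone⟩ := hΦ.adjacent f h.mem _ (h.y j)
  have hgy : ∀ m ≠ j, g (.y m) = 1 := fun m hm => hone _ (by simpa using hm) (h.y m)
  have hgu : ∀ m, g (.u m) = 1 := fun m => hone _ (by simp) (h.u m)
  have h2 := hΦ.u_sum g hg
  rw [sum_eq_of_eq_one hgy] at h2
  simp only [hgu, Finset.sum_const, Finset.card_univ, Fintype.card_fin, nsmul_eq_mul,
      mul_one] at h2
  have hz := hΦ.z_eq g hg
  have hz1 := hΦ.le_one g hg .z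
  exact ⟨g, hg, by linarith, fun m hm => hone _ (by simp) (h.v m hm), hgy, hgu⟩

lemma w_nonpos_of_isFacetTYU (hΦ : IsFacetSystem Φ) {j k : Fin b} {f : Idx a b → ℤ}
    (h : IsFacetTYU Φ j k f) : f .w ≤ 0 := by
  refine hΦ.nonpos_of_forall_eq_one h.mem (p := .z) (q := .y j) (r := .u k) fun m h1 h2 h3 h4 => ?_
  rcases m with m | m | m | m
  · exact h.v m
  · exact h.y m (by simpa using h2)
  · exact h.u m (by simpa using h3)
  · fin_cases m
    · exact absurd rfl h1
    · exact h.t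
    · exact absurd rfl h4

lemma w_nonpos_of_isFacetV (hΦ : IsFacetSystem Φ) {i : Fin a} {f : Idx a b → ℤ}
    (h : IsFacetV Φ i f) : f .w ≤ 0 := by
  refine hΦ.nonpos_of_forall_eq_one h.mem (p := .z) (q := .t) (r := .v i) fun m h1 h2 h3 h4 => ?_
  rcases m with m | m | m | m
  · exact h.v m (by simpa using h3)
  · exact h.y m
  · exact h.u m
  · fin_cases m
    · exact absurd rfl h1
    · exact absurd rfl h2
    · exact absurd rfl h4

lemma w_nonpos_of_isFacetZYU (hΦ : IsFacetSystem Φ) {j k : Fin b} {f : Idx a b → ℤ}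
    (h : IsFacetZYU Φ j k f) : f .w ≤ 0 := by
  refine hΦ.nonpos_of_forall_eq_one h.mem (p := .t) (q := .y j) (r := .u k) fun m h1 h2 h3 h4 => ?_
  rcases m with m | m | m | m
  · exact h.v m
  · exact h.y m (by simpa using h2)
  · exact h.u m (by simpa using h3)
  · fin_cases m
    · exact h.z
    · exact absurd rfl h1
    · exact absurd rfl h4

/-- Crossing the ridge of the facet missing `y_j` and `u_k` opposite to `t`. -/
lemma exists_isFacetZYU_or_of_t (hΦ : IsFacetSystem Φ) (ha : 0 < a) (j k : Fin b) :
    (∃ f, IsFacetZYU Φ j k f) ∨ ∃ f ∈ Φ, f .w = 1 ∧ f .z = 0 ∧ (∀ l, f (.v l) = 1) ∧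
      (∀ l ≠ j, f (.y l) = 1) ∧ ∀ l ≠ k, f (.u l) = 1 := by
  obtain ⟨f, h⟩ := hΦ.exists_facetTYU ha j k
  obtain ⟨g, hg, hgt, hone⟩ := hΦ.adjacent f h.mem _ h.t
  have hgv : ∀ m, g (.v m) = 1 := fun m => hone _ (by simp) (h.v m)
  have hgy : ∀ m ≠ j, g (.y m) = 1 := fun m hm => hone _ (by simp) (h.y m hm)
  have hgu : ∀ m ≠ k, g (.u m) = 1 := fun m hm => hone _ (by simp) (h.u m hm)
  have hz := hΦ.z_eq g hg
  have hz1 := hΦ.le_one g hg .z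
  by_cases hzz : g .z = 1
  · exact Or.inl ⟨g, hg, hzz, hgv, hgy, hgu⟩
  · have hz0 : g .z = 0 := by omega
    have ht0 : g .t = 0 := by omega
    refine Or.inr ⟨g, hg, ?_, hz0, hgv, hgy, hgu⟩
    have h1 := hΦ.v_sum g hg
    have h2 := hΦ.u_sum g hg
    rw [ht0, sum_eq_of_eq_one hgy] at h1 h2
    rw [sum_eq_of_eq_one hgu] at h2
    simp only [hgv, Finset.sum_const, Finset.card_univ, Fintype.card_fin, nsmul_eq_mul,
      mul_one] at h1
    have := j.pos
    refine hΦ.eq_one_of_four hg (p := .t) (q := .z) (r := .y j) (s := .u k) ?_ ?_ ?_ ?_ ?_ ?_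
    · rw [Finset.card_insert_of_notMem (by simp), Finset.card_insert_of_notMem (by simp),
        Finset.card_pair (by simp)]
    · omega
    · omega
    · intro h; rw [h] at h1; linarith
    · intro h; rw [h] at h2; linarith
    · simp

/-- Crossing the ridge of the facet missing `v_i` and `y_j` opposite to `u_k`. -/
lemma exists_isFacetZYU_or_of_u (hΦ : IsFacetSystem Φ) (i : Fin a) (j k : Fin b) :
    (∃ f, IsFacetZYU Φ j k f) ∨ ∃ f ∈ Φ, f .w = 1 ∧ f .z = 1 ∧ (∀ l ≠ i, f (.v l) = 1) ∧
      f (.v i) ≤ 0 ∧ (∀ l ≠ j, f (.y l) = 1) ∧ ∀ l ≠ k, f (.u l) = 1 := by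
  obtain ⟨f, h⟩ := hΦ.exists_facetZVY i j
  obtain ⟨g, hg, hgk, hone⟩ := hΦ.adjacent f h.mem _ (h.u k)
  have hgv : ∀ m ≠ i, g (.v m) = 1 := fun m hm => hone _ (by simp) (h.v m hm)
  have hgy : ∀ m ≠ j, g (.y m) = 1 := fun m hm => hone _ (by simp) (h.y m hm)
  have hgu : ∀ m ≠ k, g (.u m) = 1 := fun m hm => hone _ (by simpa using hm) (h.u m)
  have hgz : g .z = 1 := hone _ (by simp) h.z
  have hz := hΦ.z_eq g hg
  have hvi := hΦ.le_one_v hg i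
  by_cases hv : g (.v i) = 1
  · refine Or.inl ⟨g, hg, hgz, fun l => ?_, hgy, hgu⟩
    by_cases hl : l = i
    · rw [hl, hv]
    · exact hgv l hl
  · refine Or.inr ⟨g, hg, ?_, hgz, hgv, by omega, hgy, hgu⟩
    have h2 := hΦ.u_sum g hg
    rw [sum_eq_of_eq_one hgy, sum_eq_of_eq_one hgu] at h2
    refine hΦ.eq_one_of_four hg (p := .t) (q := .v i) (r := .y j) (s := .u k) ?_ ?_ hv ?_ ?_ ?_
    · rw [Finset.card_insert_of_notMem (by simp), Finset.card_insert_of_notMem (by simp),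
        Finset.card_pair (by simp)]
    · omega
    · omega
    · omega
    · simp

/-- Integral coordinates of the additional point, normalised so that the coefficients of the `y_l`
and of the `u_l` are nonnegative and vanish somewhere. -/
lemma exists_normalized_coords (hΦ : IsFacetSystem Φ) (ha : 0 < a) (hb : 0 < b) :
    ∃ (γ : Fin a → ℤ) (d e : Fin b → ℤ) (ζ : ℤ) (j k : Fin b),
      (∀ l, 0 ≤ d l) ∧ (∀ l, 0 ≤ e l) ∧ d j = 0 ∧ e k = 0 ∧
      ∀ g ∈ Φ, g .w = ∑ l, γ l * g (.v l) + ∑ l, d l * g (.y l) + ∑ l, e l * g (.u l) +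
        ζ * g .z := by
  obtain ⟨f, hf⟩ := hΦ.exists_facetTYU ha ⟨0, hb⟩ ⟨0, hb⟩
  obtain ⟨c, hc, hw⟩ := hΦ.coords f hf.mem
  have hcw : c .w = 0 := hc _ (by have := hΦ.w_nonpos_of_isFacetTYU hf; omega)
  have : Nonempty (Fin b) := ⟨⟨0, hb⟩⟩
  obtain ⟨j, hj⟩ := Finite.exists_min fun l : Fin b => c (.y l)
  obtain ⟨k, hk⟩ := Finite.exists_min fun l : Fin b => c (.u l)
  refine ⟨fun l => c (.v l) - (c (.u k) + c (.y j)), fun l => c (.y l) - c (.y j),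
    fun l => c (.u l) - c (.u k),
    c .z - c .t - c (.y j) - (c (.u k) + c (.y j)) * (a + b - 2), j, k,
    fun l => sub_nonneg.2 (hj l), fun l => sub_nonneg.2 (hk l), sub_self _, sub_self _,
    fun g hg => ?_⟩
  rw [hw g hg]
  have h1 := hΦ.v_sum g hg
  have h2 := hΦ.u_sum g hg
  have h3 := hΦ.z_eq g hg
  simp only [Fintype.sum_sum_type, Fin.sum_univ_three, sub_mul, Finset.sum_sub_distrib,
    ← Finset.mul_sum, hcw, zero_mul]
  rw [h3]
  linear_combination (c (.u k) + c (.y j)) * h1 + c (.u k) * h2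

theorem not_isFacetSystem (ha : 2 ≤ a) (hb : 0 < b) : ¬ IsFacetSystem Φ := by
  intro hΦ
  have ha' : 0 < a := by omega
  obtain ⟨γ, d, e, ζ, j, k, hd, he, hdj, hek, hw⟩ := hΦ.exists_normalized_coords ha' hb
  have hD : 0 ≤ ∑ l, d l := Finset.sum_nonneg fun l _ => hd l
  have hE : 0 ≤ ∑ l, e l := Finset.sum_nonneg fun l _ => he l
  have height : ∀ g ∈ Φ, ∀ i, (∀ l ≠ i, g (.v l) = 1) → (∀ l ≠ j, g (.y l) = 1) →
      (∀ l ≠ k, g (.u l) = 1) →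
      g .w = ∑ l, γ l + γ i * (g (.v i) - 1) + ∑ l, d l + ∑ l, e l + ζ * g .z := by
    intro g hg i hv hy hu
    rw [hw g hg, sum_mul_eq_of_eq_one γ hv, sum_mul_eq_of_eq_one d hy,
      sum_mul_eq_of_eq_one e hu, hdj, hek]
    ring
  obtain ⟨f, hf⟩ := hΦ.exists_facetTYU ha' j k
  have h1 := height f hf.mem ⟨0, ha'⟩ (fun l _ => hf.v l) hf.y hf.u
  have hz := hΦ.z_eq f hf.mem
  have hfw := hΦ.w_nonpos_of_isFacetTYU hf
  rw [hf.t] at hz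
  rw [hf.v, hz] at h1
  by_cases hG : ∃ g, IsFacetZYU Φ j k g
  · obtain ⟨g, hg⟩ := hG
    have h2 := height g hg.mem ⟨0, ha'⟩ (fun l _ => hg.v l) hg.y hg.u
    have hgw := hΦ.w_nonpos_of_isFacetZYU hg
    rw [hg.v, hg.z] at h2
    have : Nonempty (Fin a) := ⟨⟨0, ha'⟩⟩
    obtain ⟨i, hi⟩ := Finite.exists_min γ
    obtain ⟨p, hp⟩ := hΦ.exists_facetV hb i
    have h3 := height p hp.mem i hp.v (fun l _ => hp.y l) (fun l _ => hp.u l)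
    have hpw := hΦ.w_nonpos_of_isFacetV hp
    have hpz := hΦ.z_eq p hp.mem
    rw [hp.t] at hpz
    rw [hp.v_self, hpz] at h3
    have hsum : a * γ i ≤ ∑ l, γ l := by
      simpa using Finset.card_nsmul_le_sum Finset.univ γ (γ i) fun l _ => hi l
    have hbi : 0 ≤ (b : ℤ) * γ i := by linarith
    have hγi : 0 ≤ γ i := nonneg_of_mul_nonneg_right hbi (by exact_mod_cast hb)
    have hγ : ∀ l, 0 ≤ γ l := fun l => hγi.trans (hi l)
    have hΓ : 0 ≤ ∑ l, γ l := Finset.sum_nonneg fun l _ => hγ l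
    have hγ0 := (Finset.sum_eq_zero_iff_of_nonneg fun l _ => hγ l).1
      (by linarith : ∑ l, γ l = 0)
    have hd0 := (Finset.sum_eq_zero_iff_of_nonneg fun l _ => hd l).1
      (by linarith : ∑ l, d l = 0)
    have he0 := (Finset.sum_eq_zero_iff_of_nonneg fun l _ => he l).1
      (by linarith : ∑ l, e l = 0)
    have hζ : ζ = 0 := by linarith
    obtain ⟨q, hq, hqw⟩ := hΦ.exists_eq_one .w
    rw [hw q hq] at hqw
    simp [hγ0, hd0, he0, hζ] at hqw
  · obtain ⟨g, hg, hgw, hgz, hgv, hgy, hgu⟩ :=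
      (hΦ.exists_isFacetZYU_or_of_t ha' j k).resolve_left hG
    have h2 := height g hg ⟨0, ha'⟩ (fun l _ => hgv l) hgy hgu
    rw [hgv, hgw, hgz] at h2
    have hγ : ∀ i, 1 ≤ γ i := by
      intro i
      obtain ⟨p, hp, hpw, hpz, hpv, hpi, hpy, hpu⟩ :=
        (hΦ.exists_isFacetZYU_or_of_u i j k).resolve_left hG
      have h3 := height p hp i hpv hpy hpu
      rw [hpw, hpz] at h3
      by_contra! hneg
      nlinarith
    have hsum : (a : ℤ) ≤ ∑ l, γ l := by
      simpa using Finset.card_nsmul_le_sum Finset.univ γ 1 fun l _ => hγ l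
    have : (2 : ℤ) ≤ a := by exact_mod_cast ha
    linarith

end IsFacetSystem

end Pab

/-! ## Height vectors of facets of smooth Fano polytopes -/

namespace IsSmoothFano

variable {n : ℕ} {R : Set (Fin n → ℝ)} {κ : Type*} [Fintype κ] {p : κ → Fin n → ℝ}

lemma exists_int_eq (h : IsSmoothFano R) (hn : 0 < n) {l : Module.Dual ℝ (Fin n → ℝ)}
    (hl : IsFacetFunctional (vertexSet R) l) {x : Fin n → ℝ} (hx : IsLatticePoint x) :
    ∃ m : ℤ, l x = m := by
  obtain ⟨B, hB, hint⟩ := (h.isUnimodularBasis hn hl).exists_basis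
  choose m hm using hint x hx
  refine ⟨∑ i, m i, ?_⟩
  have hmem : ∀ i, B i ∈ {x ∈ vertexSet R | l x = 1} := fun i => hB ▸ Set.mem_range_self i
  have hone : ∀ i, l (B i) = 1 := fun i => (hmem i).2
  conv_lhs => rw [← B.sum_repr x]
  simp [hone, hm]

lemma exists_int_coords (h : IsSmoothFano R) (hn : 0 < n) (hp : Set.range p = vertexSet R)
    {l : Module.Dual ℝ (Fin n → ℝ)} (hl : IsFacetFunctional (vertexSet R) l)
    {x : Fin n → ℝ} (hx : IsLatticePoint x) :
    ∃ c : κ → ℤ, (∀ k, l (p k) ≠ 1 → c k = 0) ∧ x = ∑ k, (c k : ℝ) • p k := by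
  classical
  obtain ⟨B, hB, hint⟩ := (h.isUnimodularBasis hn hl).exists_basis
  choose m hm using hint x hx
  have hmem : ∀ i, B i ∈ {x ∈ vertexSet R | l x = 1} := fun i => hB ▸ Set.mem_range_self i
  have hidx : ∀ i, ∃ k, p k = B i := fun i => by
    have := (hmem i).1
    rwa [← hp] at this
  choose q hq using hidx
  refine ⟨fun k => ∑ i, if q i = k then m i else 0, fun k hk => ?_, ?_⟩
  · refine Finset.sum_eq_zero fun i _ => if_neg ?_
    rintro rfl
    exact hk (by rw [hq]; exact (hmem i).2)
  · simp only [Int.cast_sum, Finset.sum_smul]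
    rw [Finset.sum_comm]
    conv_lhs => rw [← B.sum_repr x]
    refine Finset.sum_congr rfl fun i _ => ?_
    simp only [Int.cast_ite, Int.cast_zero, ite_smul, zero_smul, Finset.sum_ite_eq,
      Finset.mem_univ, if_true, hq, hm]

lemma card_height_eq_one (h : IsSmoothFano R) (hn : 0 < n) (hp : Set.range p = vertexSet R)
    (hinj : Function.Injective p) {l : Module.Dual ℝ (Fin n → ℝ)}
    (hl : IsFacetFunctional (vertexSet R) l) {f : κ → ℤ} (hf : ∀ k, l (p k) = f k) :
    (Finset.univ.filter fun k => f k = 1).card = n := by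
  classical
  obtain ⟨B, hB, -⟩ := (h.isUnimodularBasis hn hl).exists_basis
  have himg : (Finset.univ.filter fun k => f k = 1).image p = Finset.univ.image B := by
    ext x
    have h1 : x ∈ Set.range B ↔ x ∈ Set.range p ∧ l x = 1 := by rw [hB, hp]; rfl
    simp only [Finset.mem_image, Finset.mem_filter, Finset.mem_univ, true_and]
    refine Iff.trans ⟨?_, ?_⟩ h1.symm
    · rintro ⟨k, hk, rfl⟩
      exact ⟨⟨k, rfl⟩, by rw [hf, hk, Int.cast_one]⟩
    · rintro ⟨⟨k, rfl⟩, hk⟩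
      exact ⟨k, by rw [hf] at hk; exact_mod_cast hk, rfl⟩
  rw [← Finset.card_image_of_injective _ hinj, himg, Finset.card_image_of_injective _ B.injective,
    Finset.card_univ, Fintype.card_fin]

end IsSmoothFano

/-- A point of `S` at which a linear functional has a strict maximum is a vertex. -/
lemma mem_vertexSet_convexHull {n : ℕ} {S : Set (Fin n → ℝ)} {x : Fin n → ℝ} (hx : x ∈ S)
    (l : Module.Dual ℝ (Fin n → ℝ)) (hl : ∀ y ∈ S, y ≠ x → l y < l x) :
    x ∈ vertexSet (convexHull ℝ S) := by
  have hconv : Convex ℝ {y | y = x ∨ l y < l x} := by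
    rw [convex_iff_forall_pos]
    intro y hy z hz p q hp hq hpq
    have hyle : l y ≤ l x := hy.elim (fun h => h ▸ le_rfl) le_of_lt
    have hzle : l z ≤ l x := hz.elim (fun h => h ▸ le_rfl) le_of_lt
    have hx' : l x = p * l x + q * l x := by rw [← add_mul, hpq, one_mul]
    simp only [Set.mem_ofPred_eq, map_add, map_smul, smul_eq_mul]
    rcases hy with rfl | hy
    · rcases hz with rfl | hz
      · left
        rw [← add_smul, hpq, one_smul]
      · right
        nlinarith
    · right
      nlinarith
  have hsub : ∀ y ∈ convexHull ℝ S, y = x ∨ l y < l x := fun y hy =>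
    convexHull_min (fun y hy => or_iff_not_imp_left.2 (hl y hy)) hconv hy
  refine exposedPoints_subset_extremePoints (𝕜 := ℝ) ⟨subset_convexHull ℝ S hx,
    LinearMap.toContinuousLinearMap l, fun y hy => ?_⟩
  rw [LinearMap.coe_toContinuousLinearMap']
  rcases hsub y hy with rfl | h
  · exact ⟨le_rfl, fun _ => rfl⟩
  · exact ⟨h.le, fun h' => absurd h (not_lt.2 h')⟩

namespace Pab

/-! ## The vertices of `P(a,b)` -/

lemma sum_ite_val_eq (m s q : ℕ) :
    ∑ i : Fin m, (if q = s + i.val then (1 : ℝ) else 0) = if s ≤ q ∧ q < s + m then 1 else 0 := by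
  rw [Fin.sum_univ_eq_sum_range (fun i => if q = s + i then (1 : ℝ) else 0)]
  by_cases h : s ≤ q ∧ q < s + m
  · obtain ⟨r, rfl⟩ := Nat.exists_eq_add_of_le h.1
    rw [if_pos h]
    simp
    omega
  · rw [if_neg h]
    refine Finset.sum_eq_zero fun i hi => if_neg ?_
    have := Finset.mem_range.1 hi
    omega

lemma z_eq_neg_t (a b : ℕ) : z a b = -t a b := by
  ext q
  simp only [z, t, Pi.neg_apply]
  split_ifs <;> simp

lemma sum_u_add_t {a b : ℕ} (ha : 0 < a) (hb : 0 < b) :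
    ∑ j, u a b j + t a b = ∑ j, y a b j := by
  obtain ⟨a, rfl⟩ := Nat.exists_eq_add_of_le' ha
  obtain ⟨b, rfl⟩ := Nat.exists_eq_add_of_le' hb
  ext q
  have hq := q.isLt
  simp only [Pi.add_apply, Finset.sum_apply, Fin.sum_univ_castSucc, u, y, t, Fin.val_castSucc,
    Fin.val_last, add_tsub_cancel_right, Fin.is_lt, if_true, lt_irrefl, if_false, sum_ite_val_eq]
  split_ifs <;> first | omega | norm_num

lemma sum_v_add_sum_y {a b : ℕ} (ha : 0 < a) (hb : 0 < b) :
    ∑ i, v a b i + ∑ j, y a b j = ((a : ℝ) + b - 1) • t a b := by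
  obtain ⟨a, rfl⟩ := Nat.exists_eq_add_of_le' ha
  obtain ⟨b, rfl⟩ := Nat.exists_eq_add_of_le' hb
  ext q
  have hq := q.isLt
  have hcast : ((a + 1 + (b + 1) - 1 : ℕ) : ℝ) = (a + 1 : ℕ) + (b + 1 : ℕ) - 1 := by
    rw [← add_assoc, add_tsub_cancel_right]
    push_cast
    ring
  have h0 := fun q => sum_ite_val_eq a 0 q
  simp only [zero_add] at h0
  simp only [Pi.add_apply, Finset.sum_apply, Fin.sum_univ_castSucc, v, y, t, Fin.val_castSucc,
    Fin.val_last, add_tsub_cancel_right, Fin.is_lt, if_true, lt_irrefl, if_false, sum_ite_val_eq,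
    h0, Pi.smul_apply, smul_eq_mul, hcast]
  split_ifs <;> first | omega | norm_num

/-- A linear functional may be prescribed on the vertices of `P(a,b)` as long as the values satisfy
the linear relations between them. -/
lemma exists_functional {a b : ℕ} (ha : 0 < a) (hb : 0 < b) (α : Fin a → ℝ) (β γ : Fin b → ℝ)
    (τ : ℝ) (h1 : ∑ j, γ j + τ = ∑ j, β j) (h2 : ∑ i, α i + ∑ j, β j = (a + b - 1) * τ) :
    ∃ l : Module.Dual ℝ (Fin (a + 2 * b - 1) → ℝ), (∀ i, l (v a b i) = α i) ∧
      (∀ j, l (y a b j) = β j) ∧ (∀ j, l (u a b j) = γ j) ∧ l (t a b) = τ := by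
  have r1 := sum_u_add_t ha hb
  have r2 := sum_v_add_sum_y ha hb
  obtain ⟨a, rfl⟩ := Nat.exists_eq_add_of_le' ha
  obtain ⟨b, rfl⟩ := Nat.exists_eq_add_of_le' hb
  let c : ℕ → ℝ := fun q =>
    if h : q < a then α ⟨q, by omega⟩
    else if h : q < a + b then β ⟨q - a, by omega⟩
    else if q = a + b then β (Fin.last b) - ∑ j : Fin b, γ j.castSucc
    else if h : q < a + b + 1 + b then γ ⟨q - (a + b + 1), by omega⟩
    else τ
  let l : Module.Dual ℝ (Fin (a + 1 + 2 * (b + 1) - 1) → ℝ) :=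
    ∑ q : Fin (a + 1 + 2 * (b + 1) - 1), c q • LinearMap.proj q
  have hl : ∀ k < a + 1 + 2 * (b + 1) - 1,
      l (fun q => if q.val = k then 1 else 0) = c k := by
    intro k hk
    have : ∀ q : Fin (a + 1 + 2 * (b + 1) - 1), q.val = k ↔ q = ⟨k, hk⟩ := fun q => by
      rw [Fin.ext_iff]
    simp [l, this]
  have ht : l (t (a + 1) (b + 1)) = τ := by
    unfold t
    rw [hl _ (by omega)]
    simp only [c]
    split_ifs <;> first | omega | rfl
  have hv : ∀ i : Fin a, l (v (a + 1) (b + 1) i.castSucc) = α i.castSucc := by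
    intro i
    have hi := i.isLt
    unfold v
    rw [if_pos (by simp), hl _ (by simp; omega)]
    simp only [c, Fin.val_castSucc, hi, dif_pos]
    rfl
  have hu : ∀ j : Fin b, l (u (a + 1) (b + 1) j.castSucc) = γ j.castSucc := by
    intro j
    have hj := j.isLt
    unfold u
    rw [if_pos (by simp), hl _ (by simp; omega)]
    simp only [c, Fin.val_castSucc]
    split_ifs <;> first | omega | skip
    congr 1
    ext
    simp
    omega
  have hy : ∀ j : Fin b, l (y (a + 1) (b + 1) j.castSucc) = β j.castSucc := by
    intro j
    have hj := j.isLt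
    unfold y
    rw [if_pos (by simp), hl _ (by simp; omega)]
    simp only [c, Fin.val_castSucc]
    split_ifs <;> first | omega | skip
    congr 1
    ext
    simp
  have hylast : l (y (a + 1) (b + 1) (Fin.last b)) = β (Fin.last b) := by
    have key : y (a + 1) (b + 1) (Fin.last b) =
        (fun q => if q.val = a + b then 1 else 0) +
          ∑ j : Fin b, u (a + 1) (b + 1) j.castSucc := by
      ext q
      simp only [y, u, Fin.val_last, Fin.val_castSucc, add_tsub_cancel_right, lt_irrefl, if_false,
        Fin.is_lt, if_true, Pi.add_apply, Finset.sum_apply, sum_ite_val_eq]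
      split_ifs <;> first | omega | norm_num
    rw [key, map_add, map_sum, hl _ (by omega)]
    simp [hu, c]
  have hulast : l (u (a + 1) (b + 1) (Fin.last b)) = γ (Fin.last b) := by
    have := congrArg l r1
    simp only [Fin.sum_univ_castSucc, map_add, map_sum, hu, hy, hylast, ht] at this h1
    linarith
  have hvlast : l (v (a + 1) (b + 1) (Fin.last a)) = α (Fin.last a) := by
    have := congrArg l r2
    simp only [Fin.sum_univ_castSucc, map_add, map_sum, map_smul, hv, hy, hylast, ht,
      smul_eq_mul] at this h2
    linarith
  exact ⟨l, Fin.lastCases hvlast hv, Fin.lastCases hylast hy, Fin.lastCases hulast hu, ht⟩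

/-- The generators of `P(a,b)` together with an additional point `w`. -/
def point (a b : ℕ) (w : Fin (a + 2 * b - 1) → ℝ) : Idx a b → Fin (a + 2 * b - 1) → ℝ :=
  Sum.elim (v a b) (Sum.elim (y a b) (Sum.elim (u a b) ![z a b, t a b, w]))

/-- Each generator of `P(a,b)` is the unique one maximising some linear functional. -/
lemma exists_functional_lt {a b : ℕ} (ha : 2 ≤ a) (hb : 2 ≤ b) (w : Fin (a + 2 * b - 1) → ℝ)
    {k : Idx a b} (hk : k ≠ .w) : ∃ l : Module.Dual ℝ (Fin (a + 2 * b - 1) → ℝ),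
      ∀ m ≠ .w, m ≠ k → l (point a b w m) < l (point a b w k) := by
  have ha' : 0 < a := by omega
  have hb' : 0 < b := by omega
  have haR : (2 : ℝ) ≤ a := by exact_mod_cast ha
  have hbR : (2 : ℝ) ≤ b := by exact_mod_cast hb
  have hinv : (b : ℝ)⁻¹ < 1 := inv_lt_one_of_one_lt₀ (by linarith)
  have hainv : 0 < (a : ℝ)⁻¹ := by positivity
  have hbinv : 0 < (b : ℝ)⁻¹ := by positivity
  suffices H : ∃ (α : Fin a → ℝ) (β γ : Fin b → ℝ) (τ : ℝ), ∑ j, γ j + τ = ∑ j, β j ∧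
      ∑ i, α i + ∑ j, β j = (a + b - 1) * τ ∧ ∀ m ≠ .w, m ≠ k →
      (Sum.elim α (Sum.elim β (Sum.elim γ ![-τ, τ, 0])) : Idx a b → ℝ) m <
        (Sum.elim α (Sum.elim β (Sum.elim γ ![-τ, τ, 0])) : Idx a b → ℝ) k by
    obtain ⟨α, β, γ, τ, h1, h2, h⟩ := H
    obtain ⟨l, hv, hy, hu, ht⟩ := exists_functional ha' hb' α β γ τ h1 h2
    have heq : ∀ m ≠ .w, l (point a b w m) =
        (Sum.elim α (Sum.elim β (Sum.elim γ ![-τ, τ, 0])) : Idx a b → ℝ) m := by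
      rintro (m | m | m | m) hm
      · exact hv m
      · exact hy m
      · exact hu m
      · fin_cases m
        · simp [point, z_eq_neg_t, ht]
        · simp [point, ht]
        · exact absurd rfl hm
    exact ⟨l, fun m hm hmk => by rw [heq m hm, heq k hk]; exact h m hm hmk⟩
  rcases k with k | k | k | k
  · refine ⟨Pi.single k 1, fun _ => -(b : ℝ)⁻¹, fun _ => -(b : ℝ)⁻¹, 0, by simp, ?_, ?_⟩
    · simp; field_simp; simp
    · rintro (m | m | m | m) hm hmk
      · simp only [ne_eq, Sum.inl.injEq] at hmk
        simp [hmk]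
      · simp; linarith
      · simp; linarith
      · fin_cases m <;> simp at hm ⊢
  · refine ⟨fun _ => -(a : ℝ)⁻¹, Pi.single k 1, fun _ => (b : ℝ)⁻¹, 0, ?_, ?_, ?_⟩
    · simp; field_simp
    · simp; field_simp; simp
    · rintro (m | m | m | m) hm hmk
      · simp; linarith
      · simp only [ne_eq, Sum.inr.injEq, Sum.inl.injEq] at hmk
        simp [hmk]
      · simp; linarith
      · fin_cases m <;> simp at hm ⊢
  · refine ⟨fun _ => -(a : ℝ)⁻¹, fun _ => (b : ℝ)⁻¹, Pi.single k 1, 0, ?_, ?_, ?_⟩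
    · simp; field_simp
    · simp; field_simp; simp
    · rintro (m | m | m | m) hm hmk
      · simp; linarith
      · simp; linarith
      · simp only [ne_eq, Sum.inr.injEq, Sum.inl.injEq] at hmk
        simp [hmk]
      · fin_cases m <;> simp at hm ⊢
  · fin_cases k
    · refine ⟨fun _ => -((a + b - 1) / a : ℝ), fun _ => 0, fun _ => (b : ℝ)⁻¹, -1, ?_, ?_, ?_⟩
      · simp; field_simp; simp
      · simp; field_simp; ring
      · have : 0 < ((a : ℝ) + b - 1) / a := div_pos (by linarith) (by linarith)
        rintro (m | m | m | m) hm hmk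
        · simp; linarith
        · simp
        · simp; linarith
        · fin_cases m <;> simp at hm hmk ⊢
    · refine ⟨fun _ => ((a + b - 1) / (a + b) : ℝ), fun _ => ((a + b - 1) / (a + b) : ℝ),
        fun _ => ((a + b - 1) / (a + b) - (b : ℝ)⁻¹ : ℝ), 1, ?_, ?_, ?_⟩
      · simp; field_simp; ring
      · simp; field_simp
      · have : ((a : ℝ) + b - 1) / (a + b) < 1 := by
          rw [div_lt_one (by linarith)]
          linarith
        rintro (m | m | m | m) hm hmk
        · simpa
        · simpa
        · simp; linarith
        · fin_cases m <;> simp at hm hmk ⊢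
    · exact absurd rfl hk

lemma point_eq_point {a b : ℕ} (w w' : Fin (a + 2 * b - 1) → ℝ) {k : Idx a b} (hk : k ≠ .w) :
    point a b w k = point a b w' k := by
  rcases k with k | k | k | k
  · rfl
  · rfl
  · rfl
  · fin_cases k
    · rfl
    · rfl
    · exact absurd rfl hk

lemma P_eq_convexHull (a b : ℕ) (w : Fin (a + 2 * b - 1) → ℝ) :
    P a b = convexHull ℝ (point a b w '' {.w}ᶜ) := by
  unfold P
  congr 1
  ext x
  constructor
  · rintro (((⟨i, rfl⟩ | ⟨i, rfl⟩) | rfl | rfl) | ⟨i, rfl⟩)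
    · exact ⟨.v i, by simp, rfl⟩
    · exact ⟨.y i, by simp, rfl⟩
    · exact ⟨.z, by simp, rfl⟩
    · exact ⟨.t, by simp, rfl⟩
    · exact ⟨.u i, by simp, rfl⟩
  · rintro ⟨k, hk, rfl⟩
    rcases k with k | k | k | k
    · exact Or.inl (Or.inl (Or.inl ⟨k, rfl⟩))
    · exact Or.inl (Or.inl (Or.inr ⟨k, rfl⟩))
    · exact Or.inr ⟨k, rfl⟩
    · fin_cases k
      · exact Or.inl (Or.inr (Or.inl rfl))
      · exact Or.inl (Or.inr (Or.inr rfl))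
      · exact absurd rfl hk

lemma point_mem_vertexSet {a b : ℕ} (ha : 2 ≤ a) (hb : 2 ≤ b) (w : Fin (a + 2 * b - 1) → ℝ)
    {k : Idx a b} (hk : k ≠ .w) : point a b w k ∈ vertexSet (P a b) := by
  obtain ⟨l, hl⟩ := exists_functional_lt ha hb w hk
  rw [P_eq_convexHull a b w]
  refine mem_vertexSet_convexHull ⟨k, hk, rfl⟩ l ?_
  rintro _ ⟨m, hm, rfl⟩ hne
  exact hl m hm fun h => hne (h ▸ rfl)

lemma point_injOn {a b : ℕ} (ha : 2 ≤ a) (hb : 2 ≤ b) (w : Fin (a + 2 * b - 1) → ℝ) :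
    Set.InjOn (point a b w) {.w}ᶜ := by
  intro k hk m hm heq
  by_contra hne
  obtain ⟨l, hl⟩ := exists_functional_lt ha hb w hk
  exact (hl m hm (Ne.symm hne)).ne (by rw [heq])

/-- If a set with `n + 4` elements contains all vertices of `P(a,b)`, then it consists of these and
one additional point. -/
lemma exists_point_enumeration {a b : ℕ} (ha : 2 ≤ a) (hb : 2 ≤ b)
    {V : Set (Fin (a + 2 * b - 1) → ℝ)} (hcard : V.ncard = (a + 2 * b - 1) + 4)
    (hsub : vertexSet (P a b) ⊆ V) :
    ∃ w, Function.Injective (point a b w) ∧ Set.range (point a b w) = V := by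
  have hV : V.Finite := Set.finite_of_ncard_ne_zero (by omega)
  have himg : point a b 0 '' {.w}ᶜ ⊆ V := by
    rintro _ ⟨k, hk, rfl⟩
    exact hsub (point_mem_vertexSet ha hb 0 hk)
  have hc : (point a b 0 '' {.w}ᶜ).ncard = (a + 2 * b - 1) + 3 := by
    rw [(point_injOn ha hb 0).ncard_image, Set.ncard_compl, Set.ncard_singleton,
      Nat.card_eq_fintype_card]
    simp only [Fintype.card_sum, Fintype.card_fin]
    omega
  have hdiff := Set.ncard_sdiff_add_ncard_of_subset himg hV
  obtain ⟨w, hw⟩ := Set.ncard_eq_one.1 (by omega : (V \ point a b 0 '' {.w}ᶜ).ncard = 1)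
  have hwV : w ∈ V \ point a b 0 '' {.w}ᶜ := by rw [hw]; rfl
  have hne : ∀ k ≠ .w, point a b w k ≠ w := fun k hk h =>
    hwV.2 ⟨k, hk, (point_eq_point 0 w hk).trans h⟩
  refine ⟨w, fun k m h => ?_, Set.Subset.antisymm ?_ fun x hx => ?_⟩
  · by_cases hk : k = .w <;> by_cases hm : m = .w
    · rw [hk, hm]
    · subst hk
      exact absurd h.symm (hne m hm)
    · subst hm
      exact absurd h (hne k hk)
    · exact point_injOn ha hb w hk hm h
  · rintro _ ⟨k, rfl⟩
    by_cases hk : k = .w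
    · subst hk
      exact hwV.1
    · exact hsub (point_mem_vertexSet ha hb w hk)
  · by_cases hx' : x ∈ point a b 0 '' {.w}ᶜ
    · obtain ⟨k, hk, rfl⟩ := hx'
      exact ⟨k, point_eq_point w 0 hk⟩
    · have : x ∈ ({w} : Set _) := hw ▸ ⟨hx, hx'⟩
      exact ⟨.w, this.symm⟩

/-- The height vectors of the facets of a smooth Fano polytope whose vertices are those of `P(a,b)`
and one further point form a facet system. -/
lemma isFacetSystem_of_isSmoothFano {a b : ℕ} (ha : 0 < a) (hb : 0 < b)
    {R : Set (Fin (a + 2 * b - 1) → ℝ)} (hR : IsSmoothFano R) {w : Fin (a + 2 * b - 1) → ℝ}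
    (hinj : Function.Injective (point a b w)) (hrange : Set.range (point a b w) = vertexSet R) :
    IsFacetSystem {f : Idx a b → ℤ | ∃ l, IsFacetFunctional (vertexSet R) l ∧
      ∀ k, l (point a b w k) = f k} := by
  have hn : 0 < a + 2 * b - 1 := by omega
  obtain ⟨hfin, hlat, hconv⟩ := hR.1.vertexSet_spec
  have h0 : 0 ∈ interior (convexHull ℝ (vertexSet R)) := hconv ▸ hR.2.1
  have hmem : ∀ k, point a b w k ∈ vertexSet R := fun k => hrange ▸ Set.mem_range_self k
  have hheight : ∀ l, IsFacetFunctional (vertexSet R) l →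
      ∃ f : Idx a b → ℤ, ∀ k, l (point a b w k) = f k := fun l hl => by
    choose f hf using fun k => hR.exists_int_eq hn hl (hlat _ (hmem k))
    exact ⟨f, hf⟩
  constructor
  · rintro f ⟨l, hl, hf⟩ k
    have := hl.1 _ (hmem k)
    rw [hf] at this
    exact_mod_cast this
  · rintro f ⟨l, hl, hf⟩
    have := congrArg l (z_eq_neg_t a b)
    rw [map_neg] at this
    have h1 : (f .z : ℝ) = -f .t := by rw [← hf, ← hf]; exact this
    exact_mod_cast h1
  · rintro f ⟨l, hl, hf⟩
    have := congrArg l (sum_u_add_t ha hb)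
    simp only [map_add, map_sum] at this
    have h1 : ∑ j, (f (.u j) : ℝ) + f .t = ∑ j, (f (.y j) : ℝ) := by simp only [← hf]; exact this
    exact_mod_cast h1
  · rintro f ⟨l, hl, hf⟩
    have := congrArg l (sum_v_add_sum_y ha hb)
    simp only [map_add, map_sum, map_smul, smul_eq_mul] at this
    have h1 : ∑ i, (f (.v i) : ℝ) + ∑ j, (f (.y j) : ℝ) = (a + b - 1) * f .t := by
      simp only [← hf]; exact this
    exact_mod_cast h1
  · rintro f ⟨l, hl, hf⟩
    have h1 := hR.card_height_eq_one hn hrange hinj hl hf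
    have h2 := Finset.card_filter_add_card_filter_not (s := Finset.univ) fun k => f k = 1
    rw [h1, Finset.card_univ] at h2
    simp only [Fintype.card_sum, Fintype.card_fin] at h2
    simp only [ne_eq]
    omega
  · rintro f ⟨l, hl, hf⟩ k hk
    obtain ⟨l', hl', hlt, hone⟩ := hl.exists_adjacent hfin h0 (hR.isUnimodularBasis hn hl)
      (hmem k) (by rw [hf, hk, Int.cast_one])
    obtain ⟨g, hg⟩ := hheight l' hl'
    refine ⟨g, ⟨l', hl', hg⟩, ?_, fun m hm hfm => ?_⟩
    · rw [hg] at hlt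
      have : g k < 1 := by exact_mod_cast hlt
      omega
    · have := hone _ (hmem m) (fun h => hm (hinj h)) (by rw [hf, hfm, Int.cast_one])
      rw [hg] at this
      exact_mod_cast this
  · intro k
    obtain ⟨l, hl, hlk⟩ := exists_isFacetFunctional_of_mem_vertexSet hn hfin hconv hR.2.1 (hmem k)
    obtain ⟨f, hf⟩ := hheight l hl
    rw [hf] at hlk
    exact ⟨f, ⟨l, hl, hf⟩, by exact_mod_cast hlk⟩
  · rintro f ⟨l, hl, hf⟩
    obtain ⟨c, hc, hw⟩ := hR.exists_int_coords hn hrange hl (hlat _ (hmem .w))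
    refine ⟨c, fun k hk => hc k ?_, ?_⟩
    · rw [hf]
      exact_mod_cast hk
    · rintro g ⟨l', -, hg⟩
      have := congrArg l' hw
      simp only [map_sum, map_smul, hg, smul_eq_mul] at this
      exact_mod_cast this

end Pab

/-- For `a, b ≥ 2` and `n = a + 2b - 1`, there is no smooth Fano
`n`-polytope `R` with `n + 4` vertices such that `V(P(a,b)) ⊆ V(R)`. -/
theorem no_smooth_Fano_superpolytope_of_Pab (a b : ℕ) (ha : 2 ≤ a) (hb : 2 ≤ b) :
    ¬ ∃ R : Set (Fin (a + 2 * b - 1) → ℝ), IsSmoothFano R ∧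
      (vertexSet R).ncard = (a + 2 * b - 1) + 4 ∧
      vertexSet (Pab.P a b) ⊆ vertexSet R := by
  rintro ⟨R, hR, hcard, hsub⟩
  obtain ⟨w, hinj, hrange⟩ := Pab.exists_point_enumeration ha hb hcard hsub
  exact Pab.IsFacetSystem.not_isFacetSystem ha (by omega)
    (Pab.isFacetSystem_of_isSmoothFano (by omega) (by omega) hR hinj hrange)
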